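/- arXiv:1510.01952 — 2 statements merged into one kernel-verified Lean document; each statement's English description precedes it below -/
import Mathlib

section
/- Let c_n denote the number of DDD-equivalence classes of ballot paths of length n (so c₀ = 1), and let B = ∑_{n≥0} c_n xⁿ be its generating function. Then in the ring of formal power series over ℚ, x²(1 − 2x + x² − x⁴)·B³ + 2x(1 − x)²·B² + (1 − 3x + x²)·B − 1 = 0. -/
/-- A path is a list of steps: `true` is an up-step U, `false` is a down-step D. -/
abbrev Step := Bool

/-- The height of the `j`-th lattice point of the path `p`. -/
def pathHeight (p : List Bool) (j : ℕ) : ℤ :=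
  ((p.take j).count true : ℤ) - ((p.take j).count false : ℤ)

/-- A ballot path: every prefix has at least as many U's as D's. -/
def IsBallot (p : List Bool) : Prop :=
  ∀ k : ℕ, (p.take k).count false ≤ (p.take k).count true

/-- A Dyck path: a ballot path with equally many U's and D's. -/
def IsDyck (p : List Bool) : Prop :=
  IsBallot p ∧ p.count true = p.count false

/-- The string `τ` occurs at (0-indexed) position `i` of the path `p`. -/
def OccursAt (τ p : List Bool) (i : ℕ) : Prop :=
  (p.drop i).take τ.length = τ

/-- Two paths are `τ`-equivalent: same length and occurrences of `τ` at the same positions. -/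
def PathEquiv (τ p q : List Bool) : Prop :=
  p.length = q.length ∧ ∀ i : ℕ, OccursAt τ p i ↔ OccursAt τ q i

/-- The setoid of `τ`-equivalence on ballot paths of length `n`. -/
def ballotSetoid (τ : List Bool) (n : ℕ) :
    Setoid {p : List Bool // IsBallot p ∧ p.length = n} where
  r p q := PathEquiv τ p.1 q.1
  iseqv := ⟨fun _ => ⟨rfl, fun _ => Iff.rfl⟩,
            fun h => ⟨h.1.symm, fun i => (h.2 i).symm⟩,
            fun h1 h2 => ⟨h1.1.trans h2.1, fun i => (h1.2 i).trans (h2.2 i)⟩⟩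

/-- The number of `τ`-equivalence classes of ballot paths of length `n`. -/
noncomputable def numBallotClasses (τ : List Bool) (n : ℕ) : ℕ :=
  Nat.card (Quotient (ballotSetoid τ n))

/-- The setoid of `τ`-equivalence on Dyck paths of semilength `n`. -/
def dyckSetoid (τ : List Bool) (n : ℕ) :
    Setoid {p : List Bool // IsDyck p ∧ p.length = 2 * n} where
  r p q := PathEquiv τ p.1 q.1
  iseqv := ⟨fun _ => ⟨rfl, fun _ => Iff.rfl⟩,
            fun h => ⟨h.1.symm, fun i => (h.2 i).symm⟩,
            fun h1 h2 => ⟨h1.1.trans h2.1, fun i => (h1.2 i).trans (h2.2 i)⟩⟩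

/-- The number of `τ`-equivalence classes of Dyck paths of semilength `n`. -/
noncomputable def numDyckClasses (τ : List Bool) (n : ℕ) : ℕ :=
  Nat.card (Quotient (dyckSetoid τ n))

/-- The number of words of length `n` satisfying `P`. -/
noncomputable def wordCount (P : List Bool → Prop) (n : ℕ) : ℕ :=
  {p | P p ∧ p.length = n}.ncard

theorem wordCount_zero_of_nil {P : List Bool → Prop} (h : P []) : wordCount P 0 = 1 := by
  rw [wordCount, Set.ncard_eq_one]
  refine ⟨[], Set.ext fun p => ?_⟩
  simp only [Set.mem_ofPred_eq, List.length_eq_zero_iff, Set.mem_singleton_iff]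
  exact ⟨fun hp => hp.2, fun hp => ⟨hp ▸ h, hp⟩⟩

theorem wordCount_zero_of_not_nil {P : List Bool → Prop} (h : ¬ P []) : wordCount P 0 = 0 := by
  have : {p : List Bool | P p ∧ p.length = 0} = ∅ := by
    ext p
    simp only [Set.mem_ofPred_eq, List.length_eq_zero_iff, Set.mem_empty_iff_false, iff_false]
    rintro ⟨hp, rfl⟩
    exact h hp
  rw [wordCount, this, Set.ncard_empty]

theorem finite_words (P : List Bool → Prop) (n : ℕ) : {p | P p ∧ p.length = n}.Finite :=
  (List.finite_length_eq Bool n).subset fun _ hp => hp.2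

theorem wordCount_succ (P : List Bool → Prop) (n : ℕ) :
    wordCount P (n + 1) =
      wordCount (fun p => P (true :: p)) n + wordCount (fun p => P (false :: p)) n := by
  have hsplit : {p | P p ∧ p.length = n + 1} =
      List.cons true '' {p | P (true :: p) ∧ p.length = n} ∪
        List.cons false '' {p | P (false :: p) ∧ p.length = n} := by
    ext (_ | ⟨_ | _, p⟩) <;> simp
  rw [wordCount, hsplit, Set.ncard_union_eq ?_ ((finite_words _ _).image _)
    ((finite_words _ _).image _), Set.ncard_image_of_injective _ List.cons_injective,
    Set.ncard_image_of_injective _ List.cons_injective]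
  · rfl
  · rw [Set.disjoint_left]
    rintro _ ⟨p, -, rfl⟩ ⟨q, -, h⟩
    simp at h

open PowerSeries in
/-- The length generating function of the words satisfying `P`. -/
noncomputable def wordGF (P : List Bool → Prop) : PowerSeries ℚ :=
  PowerSeries.mk fun n => (wordCount P n : ℚ)

open PowerSeries in
theorem wordGF_of_nil {P : List Bool → Prop} (h : P []) :
    wordGF P = 1 + X * (wordGF (fun p => P (true :: p)) + wordGF fun p => P (false :: p)) := by
  ext (_ | n)
  · simp [wordGF, wordCount_zero_of_nil h]
  · simp [wordGF, wordCount_succ, coeff_succ_X_mul, coeff_one]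

open PowerSeries in
theorem wordGF_of_not_nil {P : List Bool → Prop} (h : ¬ P []) :
    wordGF P = X * (wordGF (fun p => P (true :: p)) + wordGF fun p => P (false :: p)) := by
  ext (_ | n)
  · simp [wordGF, wordCount_zero_of_not_nil h]
  · simp [wordGF, wordCount_succ, coeff_succ_X_mul]

theorem wordGF_eq_zero {P : List Bool → Prop} (h : ∀ p, ¬ P p) : wordGF P = 0 := by
  ext n
  simp [wordGF, wordCount, h]

theorem wordGF_congr {P Q : List Bool → Prop} (h : ∀ p, P p ↔ Q p) : wordGF P = wordGF Q := by
  rw [funext fun p => propext (h p)]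

/-- The path `p`, started at height `h`, stays at nonnegative height. -/
def IsBallotFrom (h : ℤ) (p : List Bool) : Prop :=
  ∀ k : ℕ, ((p.take k).count false : ℤ) ≤ (p.take k).count true + h

theorem IsBallotFrom.nonneg {h : ℤ} {p : List Bool} (hp : IsBallotFrom h p) : 0 ≤ h := by
  simpa using hp 0

theorem isBallotFrom_nil {h : ℤ} : IsBallotFrom h [] ↔ 0 ≤ h := by
  simp [IsBallotFrom]

theorem isBallotFrom_zero {p : List Bool} : IsBallotFrom 0 p ↔ IsBallot p := by
  simp [IsBallotFrom, IsBallot]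

theorem isBallotFrom_cons_true {h : ℤ} (hh : 0 ≤ h) {p : List Bool} :
    IsBallotFrom h (true :: p) ↔ IsBallotFrom (h + 1) p := by
  refine ⟨fun H k => ?_, fun H k => ?_⟩
  · have := H (k + 1)
    simp at this
    linarith
  · rcases k with _ | k
    · simpa using hh
    · have := H k
      simp
      linarith

theorem isBallotFrom_cons_false {h : ℤ} {p : List Bool} :
    IsBallotFrom h (false :: p) ↔ IsBallotFrom (h - 1) p := by
  refine ⟨fun H k => ?_, fun H k => ?_⟩
  · have := H (k + 1)
    simp at this
    linarith
  · rcases k with _ | k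
    · have := H.nonneg
      simp
      linarith
    · have := H k
      simp
      linarith

/-- Position `j` of `p` is covered by an occurrence of `DDD`. -/
def IsCovered (p : List Bool) (j : ℕ) : Prop :=
  ∃ i, i ≤ j ∧ j ≤ i + 2 ∧
    p[i]? = some false ∧ p[i + 1]? = some false ∧ p[i + 2]? = some false

/-- Every down-step of `p` lies in an occurrence of `DDD`. -/
def AllCovered (p : List Bool) : Prop :=
  ∀ j, p[j]? = some false → IsCovered p j

theorem IsCovered.getElem? {p : List Bool} {j : ℕ} (h : IsCovered p j) : p[j]? = some false := by
  obtain ⟨i, h1, h2, h3, h4, h5⟩ := h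
  obtain rfl | rfl | rfl : j = i ∨ j = i + 1 ∨ j = i + 2 := by omega
  all_goals assumption

theorem IsCovered.cons {a : Bool} {p : List Bool} {j : ℕ} (h : IsCovered p j) :
    IsCovered (a :: p) (j + 1) := by
  obtain ⟨i, h1, h2, h3, h4, h5⟩ := h
  exact ⟨i + 1, by omega, by omega, by simpa using h3, by simpa using h4, by simpa using h5⟩

theorem IsCovered.of_cons_true {p : List Bool} {j : ℕ} (h : IsCovered (true :: p) (j + 1)) :
    IsCovered p j := by
  obtain ⟨_ | i, h1, h2, h3, h4, h5⟩ := h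
  · simp at h3
  · exact ⟨i, by omega, by omega, by simpa using h3, by simpa using h4, by simpa using h5⟩

theorem allCovered_nil : AllCovered [] := by
  simp [AllCovered]

theorem allCovered_cons_true {p : List Bool} : AllCovered (true :: p) ↔ AllCovered p := by
  refine ⟨fun H j hj => (H (j + 1) (by simpa using hj)).of_cons_true, fun H j hj => ?_⟩
  rcases j with _ | j
  · simp at hj
  · exact (H j (by simpa using hj)).cons

theorem isCovered_triple {p : List Bool} {j : ℕ} (hj : j ≤ 2) :
    IsCovered (false :: false :: false :: p) j :=
  ⟨0, by omega, by omega, by simp, by simp, by simp⟩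

theorem not_allCovered_down : ¬ AllCovered [false] := fun H => by
  obtain ⟨i, h1, -, -, h4, -⟩ := H 0 rfl
  simp at h4

theorem not_allCovered_down_up {p : List Bool} : ¬ AllCovered (false :: true :: p) := fun H => by
  obtain ⟨i, h1, -, -, h4, -⟩ := H 0 rfl
  obtain rfl : i = 0 := by omega
  simp at h4

theorem not_allCovered_down_down : ¬ AllCovered [false, false] := fun H => by
  obtain ⟨i, h1, -, -, -, h5⟩ := H 0 rfl
  simp at h5

theorem not_allCovered_down_down_up {p : List Bool} :
    ¬ AllCovered (false :: false :: true :: p) := fun H => by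
  obtain ⟨i, h1, -, -, -, h5⟩ := H 0 rfl
  obtain rfl : i = 0 := by omega
  simp at h5

theorem allCovered_triple_up {p : List Bool} :
    AllCovered (false :: false :: false :: true :: p) ↔ AllCovered p := by
  constructor
  · intro H j hj
    obtain ⟨i, h1, h2, h3, h4, h5⟩ := H (j + 4) (by simpa using hj)
    obtain rfl | rfl | ⟨i, rfl⟩ : i = 2 ∨ i = 3 ∨ ∃ k, i = k + 4 := by
      rcases i with _ | _ | _ | _ | i
      · omega
      · omega
      · simp
      · simp
      · exact .inr (.inr ⟨i, rfl⟩)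
    · simp at h4
    · simp at h3
    · exact ⟨i, by omega, by omega, by simpa using h3, by simpa using h4, by simpa using h5⟩
  · rintro H (_ | _ | _ | _ | j) hj
    · exact isCovered_triple (by omega)
    · exact isCovered_triple (by omega)
    · exact isCovered_triple (by omega)
    · simp at hj
    · exact (H j (by simpa using hj)).cons.cons.cons.cons

theorem allCovered_triple : AllCovered [false, false, false] := by
  rintro (_ | _ | _ | j) hj
  · exact isCovered_triple (by omega)
  · exact isCovered_triple (by omega)
  · exact isCovered_triple (by omega)
  · simp at hj

theorem allCovered_triple_down {p : List Bool} :
    AllCovered (false :: false :: false :: false :: p) ↔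
      AllCovered (false :: false :: false :: p) := by
  constructor
  · intro H j hj
    rcases le_or_gt j 2 with hj2 | hj2
    · exact isCovered_triple hj2
    · obtain ⟨_ | i, h1, h2, h3, h4, h5⟩ := H (j + 1) (by simpa using hj)
      · omega
      · exact ⟨i, by omega, by omega, by simpa using h3, by simpa using h4, by simpa using h5⟩
  · rintro H (_ | j) hj
    · exact isCovered_triple (by omega)
    · exact (H j (by simpa using hj)).cons

/-- The generating function of the covered paths from height `h` that, when preceded by the
word `w`, have all their down-steps in occurrences of `DDD`. -/
noncomputable def coveredGF (w : List Bool) (h : ℤ) : PowerSeries ℚ :=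
  wordGF fun p => IsBallotFrom h p ∧ AllCovered (w ++ p)

theorem coveredGF_of_neg (w : List Bool) {h : ℤ} (hh : h < 0) : coveredGF w h = 0 :=
  wordGF_eq_zero fun _ hp => hh.not_ge hp.1.nonneg

theorem wordGF_cons_false (w : List Bool) (h : ℤ) :
    (wordGF fun p => IsBallotFrom h (false :: p) ∧ AllCovered (w ++ false :: p)) =
      coveredGF (w ++ [false]) (h - 1) :=
  wordGF_congr fun p => by simp [isBallotFrom_cons_false]

theorem wordGF_cons_true {w : List Bool} (hw : ∀ p, AllCovered (w ++ true :: p) ↔ AllCovered p)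
    {h : ℤ} (hh : 0 ≤ h) :
    (wordGF fun p => IsBallotFrom h (true :: p) ∧ AllCovered (w ++ true :: p)) =
      coveredGF [] (h + 1) :=
  wordGF_congr fun p => by simp [isBallotFrom_cons_true hh, hw]

open PowerSeries in
theorem coveredGF_nil {h : ℤ} (hh : 0 ≤ h) :
    coveredGF [] h = 1 + X * (coveredGF [] (h + 1) + coveredGF [false] (h - 1)) := by
  rw [coveredGF, wordGF_of_nil ⟨isBallotFrom_nil.2 hh, allCovered_nil⟩, wordGF_cons_false,
    wordGF_cons_true (fun _ => allCovered_cons_true) hh]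
  rfl

open PowerSeries in
theorem coveredGF_down (h : ℤ) :
    coveredGF [false] h = X * coveredGF [false, false] (h - 1) := by
  rw [coveredGF, wordGF_of_not_nil fun hp => not_allCovered_down hp.2, wordGF_cons_false,
    wordGF_eq_zero fun p hp => not_allCovered_down_up hp.2, zero_add]
  rfl

open PowerSeries in
theorem coveredGF_down_down (h : ℤ) :
    coveredGF [false, false] h = X * coveredGF [false, false, false] (h - 1) := by
  rw [coveredGF, wordGF_of_not_nil fun hp => not_allCovered_down_down hp.2, wordGF_cons_false,
    wordGF_eq_zero fun p hp => not_allCovered_down_down_up hp.2, zero_add]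
  rfl

open PowerSeries in
theorem coveredGF_triple {h : ℤ} (hh : 0 ≤ h) :
    coveredGF [false, false, false] h =
      1 + X * (coveredGF [] (h + 1) + coveredGF [false, false, false] (h - 1)) := by
  have hdown : coveredGF ([false, false, false] ++ [false]) (h - 1) =
      coveredGF [false, false, false] (h - 1) :=
    wordGF_congr fun p => and_congr_right fun _ => allCovered_triple_down
  rw [coveredGF, wordGF_of_nil ⟨isBallotFrom_nil.2 hh, allCovered_triple⟩, wordGF_cons_false,
    wordGF_cons_true (fun _ => allCovered_triple_up) hh, hdown]

open PowerSeries in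
theorem coveredGF_nil_eq (h : ℤ) :
    coveredGF [] h = coveredGF [false, false, false] h -
      X * coveredGF [false, false, false] (h - 1) +
        X ^ 3 * coveredGF [false, false, false] (h - 3) := by
  rcases lt_or_ge h 0 with hh | hh
  · simp [coveredGF_of_neg _ hh, coveredGF_of_neg _ (show h - 1 < 0 by omega),
      coveredGF_of_neg _ (show h - 3 < 0 by omega)]
  · rw [coveredGF_nil hh, coveredGF_triple hh, coveredGF_down, coveredGF_down_down,
      show h - 1 - 1 - 1 = h - 3 by ring]
    ring

open PowerSeries in
theorem coveredGF_recurrence {h : ℤ} (hh : 0 ≤ h) :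
    (1 + X ^ 2) * coveredGF [false, false, false] h =
      1 + X * coveredGF [false, false, false] (h + 1) +
        X * coveredGF [false, false, false] (h - 1) +
          X ^ 4 * coveredGF [false, false, false] (h - 2) := by
  have h1 := coveredGF_triple hh
  rw [coveredGF_nil_eq, show h + 1 - 1 = h by ring, show h + 1 - 3 = h - 2 by ring] at h1
  linear_combination h1

open PowerSeries in
/-- The kernel method for the recurrence `coveredGF_recurrence`: a root `y` of the kernel without
constant term determines the value at height zero. -/
theorem kernel_method {R : Type*} [CommRing R] (a : ℤ → R⟦X⟧) (y : R⟦X⟧)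
    (ha : ∀ h, 0 ≤ h →
      (1 + X ^ 2) * a h = 1 + X * a (h + 1) + X * a (h - 1) + X ^ 4 * a (h - 2))
    (ha1 : a (-1) = 0) (ha2 : a (-2) = 0) (hy : X ∣ y)
    (hker : (1 + X ^ 2) * y = X + X ^ 4 * y ^ 3 + X * y ^ 2) :
    (1 - y) * (X * a 0) = y := by
  have key (n : ℕ) : (1 - y) * (X * a 0) - y = y ^ n * ((1 - y) *
      (X * a n - (X * y + X ^ 4 * y ^ 2) * a (n - 1) - X ^ 4 * y * a (n - 2)) - y) := by
    induction n with
    | zero => simp [ha1, ha2]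
    | succ n ih =>
      rw [ih]
      have h1 := ha n (by positivity)
      push_cast
      rw [show (n : ℤ) + 1 - 1 = n by ring, show (n : ℤ) + 1 - 2 = n - 1 by ring]
      linear_combination y ^ n * (1 - y) * (-(a n) * hker + y * h1)
  rw [← sub_eq_zero]
  ext n
  have hdvd : X ^ (n + 1) ∣ (1 - y) * (X * a 0) - y :=
    (pow_dvd_pow_of_dvd hy _).trans ⟨_, key (n + 1)⟩
  simpa using X_pow_dvd_iff.1 hdvd n (by omega)

open PowerSeries in
theorem exists_reciprocal_kernel_root : ∃ u : ℚ⟦X⟧, constantCoeff u = 1 ∧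
    u ^ 3 - (1 + X ^ 2) * u ^ 2 + X ^ 2 * u + X ^ 6 = 0 := by
  let f : Polynomial ℚ⟦X⟧ := Polynomial.X ^ 3 - Polynomial.C (1 + X ^ 2) * Polynomial.X ^ 2 +
    Polynomial.C (X ^ 2) * Polynomial.X + Polynomial.C (X ^ 6)
  have hmonic : f.Monic := by
    dsimp only [f]
    monicity!
  have hunit : IsUnit (f.derivative.eval 1) := by
    rw [isUnit_iff_constantCoeff]
    simp [f, Polynomial.derivative_pow, map_ofNat]
    norm_num
  obtain ⟨u, hu, hu1⟩ := HenselianRing.is_henselian (I := Ideal.span {(X : ℚ⟦X⟧)}) f hmonic 1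
    (Ideal.mem_span_singleton.2 ⟨X ^ 5, by simp [f]; ring⟩) (hunit.map _)
  refine ⟨u, ?_, by simpa [f, Polynomial.IsRoot.def] using hu⟩
  rw [Ideal.mem_span_singleton, X_dvd_iff] at hu1
  simpa [sub_eq_zero] using hu1

open PowerSeries in
theorem coveredGF_cubic {B : ℚ⟦X⟧} (hB : B = coveredGF [] 0) :
    X ^ 2 * (1 - 2 * X + X ^ 2 - X ^ 4) * B ^ 3 + 2 * X * (1 - X) ^ 2 * B ^ 2 +
      (1 - 3 * X + X ^ 2) * B - 1 = 0 := by
  have hB' : B = coveredGF [false, false, false] 0 := by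
    simp [hB, coveredGF_nil_eq, coveredGF_of_neg]
  obtain ⟨u, hu1, hu⟩ := exists_reciprocal_kernel_root
  have hinv : u * u⁻¹ = 1 := PowerSeries.mul_inv_cancel u (by simp [hu1])
  set F := u⁻¹
  have hval := kernel_method (coveredGF [false, false, false]) (X * F)
    (fun h hh => coveredGF_recurrence hh) (coveredGF_of_neg _ (by norm_num))
    (coveredGF_of_neg _ (by norm_num)) (dvd_mul_right _ _) (by
      linear_combination -X * F ^ 3 * hu + X * ((1 + u * F + (u * F) ^ 2) -
        (1 + X ^ 2) * F * (u * F + 1) + X ^ 2 * F ^ 2) * hinv)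
  rw [← hB'] at hval
  have huB : u * B = 1 + X * B := by
    have : X * (u * B) = X * (1 + X * B) := by
      linear_combination u * hval + (X + X ^ 2 * B) * hinv
    exact mul_left_cancel₀ X_ne_zero this
  linear_combination -B ^ 3 * hu + ((u * B) ^ 2 + u * B * (1 + X * B) + (1 + X * B) ^ 2 -
    (1 + X ^ 2) * B * (u * B + (1 + X * B)) + X ^ 2 * B ^ 2) * huB

theorem occursAt_down_iff {p : List Bool} {i : ℕ} :
    OccursAt [false, false, false] p i ↔
      p[i]? = some false ∧ p[i + 1]? = some false ∧ p[i + 2]? = some false := by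
  have h : ∀ k, (p.drop i)[k]? = p[i + k]? := fun k => List.getElem?_drop
  rw [← h 1, ← h 2, show p[i]? = (p.drop i)[0]? by simp, OccursAt]
  rcases p.drop i with _ | ⟨a, _ | ⟨b, _ | ⟨c, l⟩⟩⟩ <;> simp

theorem PathEquiv.isCovered_iff {p q : List Bool} (h : PathEquiv [false, false, false] p q)
    (j : ℕ) : IsCovered p j ↔ IsCovered q j := by
  simp only [IsCovered, ← occursAt_down_iff, h.2]

theorem eq_of_pathEquiv {p q : List Bool} (h : PathEquiv [false, false, false] p q)
    (hp : AllCovered p) (hq : AllCovered q) : p = q := by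
  have hiff (j : ℕ) : p[j]? = some false ↔ q[j]? = some false :=
    ⟨fun hj => ((h.isCovered_iff j).1 (hp j hj)).getElem?,
      fun hj => ((h.isCovered_iff j).2 (hq j hj)).getElem?⟩
  refine List.ext_getElem h.1 fun j h1 h2 => ?_
  have := hiff j
  rw [List.getElem?_eq_getElem h1, List.getElem?_eq_getElem h2] at this
  cases hp' : p[j] <;> cases hq' : q[j] <;> simp_all

open Classical in
/-- The path obtained from `p` by turning every down-step outside the occurrences of `DDD`
into an up-step. -/
noncomputable def raise (p : List Bool) : List Bool :=
  List.ofFn fun j : Fin p.length => !decide (IsCovered p j)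

theorem length_raise (p : List Bool) : (raise p).length = p.length := by
  simp [raise]

theorem getElem?_raise (p : List Bool) (j : ℕ) : (raise p)[j]? = some false ↔ IsCovered p j := by
  classical
  simp only [raise, List.getElem?_ofFn]
  split_ifs with hj
  · simp
  · refine ⟨by simp, fun h => ?_⟩
    have := h.getElem?
    rw [List.getElem?_eq_some_iff] at this
    exact absurd this.1 hj

theorem isCovered_of_occursAt {p : List Bool} {i j : ℕ}
    (h : OccursAt [false, false, false] p i) (hij : i ≤ j) (hji : j ≤ i + 2) : IsCovered p j :=
  ⟨i, hij, hji, occursAt_down_iff.1 h⟩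

theorem pathEquiv_raise (p : List Bool) : PathEquiv [false, false, false] (raise p) p := by
  refine ⟨length_raise p, fun i => ⟨fun h => ?_, fun h => ?_⟩⟩
  · simp only [occursAt_down_iff, getElem?_raise] at h ⊢
    exact ⟨h.1.getElem?, h.2.1.getElem?, h.2.2.getElem?⟩
  · simp only [occursAt_down_iff (p := raise p), getElem?_raise]
    exact ⟨isCovered_of_occursAt h (by omega) (by omega),
      isCovered_of_occursAt h (by omega) (by omega), isCovered_of_occursAt h (by omega) (by omega)⟩

theorem allCovered_raise (p : List Bool) : AllCovered (raise p) := fun j hj =>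
  ((pathEquiv_raise p).isCovered_iff j).2 ((getElem?_raise p j).1 hj)

theorem IsBallot.of_down_imp_down {p q : List Bool} (hlen : p.length = q.length)
    (h : ∀ j : ℕ, q[j]? = some false → p[j]? = some false) (hp : IsBallot p) : IsBallot q := by
  have hle (k : ℕ) : (q.take k).count false ≤ (p.take k).count false := by
    induction k with
    | zero => simp
    | succ k ih =>
      rw [List.take_add_one, List.take_add_one, List.count_append, List.count_append]
      refine add_le_add ih ?_
      rcases hq : q[k]? with _ | _ | _
      · simp
      · simp [h k hq]
      · simp
  have hsum (l : List Bool) : l.count true + l.count false = l.length := by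
    simp [add_comm]
  intro k
  have h1 := hle k
  have h2 := hp k
  have h3 := hsum (p.take k)
  have h4 := hsum (q.take k)
  rw [List.length_take] at h3 h4
  omega

theorem isBallot_raise {p : List Bool} (hp : IsBallot p) : IsBallot (raise p) :=
  hp.of_down_imp_down (length_raise p).symm fun j hj => ((getElem?_raise p j).1 hj).getElem?

theorem numBallotClasses_down_eq (n : ℕ) :
    numBallotClasses [false, false, false] n =
      wordCount (fun p => IsBallotFrom 0 p ∧ AllCovered ([] ++ p)) n := by
  rw [numBallotClasses, wordCount, ← Nat.card_coe_set_eq]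
  symm
  refine Nat.card_eq_of_bijective (fun p => Quotient.mk (ballotSetoid [false, false, false] n)
    ⟨p.1, isBallotFrom_zero.1 p.2.1.1, p.2.2⟩) ⟨?_, ?_⟩
  · rintro ⟨p, hp⟩ ⟨q, hq⟩ h
    exact Subtype.ext (eq_of_pathEquiv (Quotient.exact h) hp.1.2 hq.1.2)
  · rintro ⟨p, hp, hn⟩
    exact ⟨⟨raise p, ⟨isBallotFrom_zero.2 (isBallot_raise hp), allCovered_raise p⟩,
      (length_raise p).trans hn⟩, Quotient.sound (pathEquiv_raise p)⟩

open PowerSeries in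
/-- the generating function of the numbers of DDD-equivalence classes of
ballot paths satisfies the cubic equation
`x^2 (1 - 2x + x^2 - x^4) B^3 + 2x (1-x)^2 B^2 + (1 - 3x + x^2) B - 1 = 0`. -/
theorem ddd_classes_gf (B : PowerSeries ℚ)
    (hB : B = PowerSeries.mk fun n => (numBallotClasses [false, false, false] n : ℚ)) :
    X ^ 2 * (1 - 2 * X + X ^ 2 - X ^ 4) * B ^ 3 + 2 * X * (1 - X) ^ 2 * B ^ 2 +
      (1 - 3 * X + X ^ 2) * B - 1 = 0 :=
  coveredGF_cubic (by simp only [hB, numBallotClasses_down_eq, coveredGF, wordGF])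
end

section
/- Let c_n denote the number of DUD-equivalence classes of ballot paths of length n (so c₀ = 1), and let B = ∑_{n≥0} c_n xⁿ be its generating function. Then in the ring of formal power series over ℚ, x²(1 − x − x²)·B³ + (2x − 3x² − 2x³ + 2x⁴ + 2x⁵ − 2x⁶)·B² + (1 − 3x − x² + 3x³ + x⁴ − 3x⁵)·B − 1 + x² − x⁴ = 0. -/
/-! ### Occurrences of DUD and canonical paths -/

namespace DudClasses

/-- The word `c b a w`, continued by infinitely many up-steps. -/
def pad (c b a : Bool) (w : List Bool) (i : ℕ) : Bool := (c :: b :: a :: w).getD i true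

/-- `DUD` occurs at position `i` of the infinite word `a`. -/
def Occ (a : ℕ → Bool) (i : ℕ) : Prop := a i = false ∧ a (i + 1) = true ∧ a (i + 2) = false

/-- From index `3` on, each down-step of `a` is an end of a `DUD`
or the middle letter of a factor `DUDDDUD`. -/
def Canonical (a : ℕ → Bool) : Prop :=
  ∀ i, a (i + 3) = false → Occ a (i + 3) ∨ Occ a (i + 1) ∨ (Occ a i ∧ Occ a (i + 4))

/-- The down-steps that are forced by the occurrences of `DUD`. -/
def Forced (a : ℕ → Bool) (i : ℕ) : Prop :=
  Occ a (i + 3) ∨ Occ a (i + 1) ∨ (Occ a i ∧ Occ a (i + 4) ∧ ¬ Occ a (i + 2))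

lemma occursAt_iff (p : List Bool) (i : ℕ) :
    OccursAt [false, true, false] p i ↔ Occ (pad true true true p) (i + 3) := by
  have key (k : ℕ) : pad true true true p (i + 3 + k) = (p.drop i).getD k true := by
    have h : i + 3 + k = i + k + 1 + 1 + 1 := by ring
    simp [pad, h, List.getD_eq_getElem?_getD]
  unfold OccursAt Occ
  rw [key 1, key 2, show i + 3 = i + 3 + 0 from rfl, key 0]
  rcases p.drop i with _ | ⟨a, _ | ⟨b, _ | ⟨c, l⟩⟩⟩ <;> simp

lemma not_occ_pad_of_lt (p : List Bool) {i : ℕ} (hi : i < 3) :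
    ¬ Occ (pad true true true p) i := by
  intro h
  have := h.1
  interval_cases i <;> simp [pad] at this

lemma eq_false_of_forced {a : ℕ → Bool} {i : ℕ} (h : Forced a i) : a (i + 3) = false := by
  unfold Forced Occ at h
  grind

lemma Canonical.eq_false_iff {a : ℕ → Bool} (h : Canonical a) (i : ℕ) :
    a (i + 3) = false ↔ Forced a i := by
  refine ⟨fun hi => ?_, eq_false_of_forced⟩
  have := h i hi
  unfold Forced Occ at *
  grind

lemma occ_iff_of_forced {a b : ℕ → Bool} (hb : ∀ i, b (i + 3) = false ↔ Forced a i) (i : ℕ) :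
    Occ b (i + 3) ↔ Occ a (i + 3) := by
  have h0 := hb i
  have h1 := hb (i + 1)
  have h2 := hb (i + 2)
  unfold Forced at h0 h1 h2
  unfold Occ at *
  grind

lemma occ_congr {p q : List Bool} (h : PathEquiv [false, true, false] p q) (i : ℕ) :
    Occ (pad true true true p) i ↔ Occ (pad true true true q) i := by
  rcases lt_or_ge i 3 with hi | hi
  · simp [not_occ_pad_of_lt _ hi]
  · obtain ⟨j, rfl⟩ := Nat.exists_eq_add_of_le' hi
    rw [← occursAt_iff, ← occursAt_iff]
    exact h.2 j

lemma eq_of_pad_eq {p q : List Bool} (hl : p.length = q.length)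
    (h : ∀ i, pad true true true p (i + 3) = pad true true true q (i + 3)) : p = q := by
  refine List.ext_getElem hl fun i h1 h2 => ?_
  simpa [pad, h1, h2] using h i

lemma Canonical.eq_of_pathEquiv {p q : List Bool} (hp : Canonical (pad true true true p))
    (hq : Canonical (pad true true true q)) (h : PathEquiv [false, true, false] p q) : p = q := by
  refine eq_of_pad_eq h.1 fun i => ?_
  have h1 := hp.eq_false_iff i
  have h2 := hq.eq_false_iff i
  unfold Forced at h1 h2
  simp only [occ_congr h] at h1
  rw [← h2] at h1
  exact Bool.eq_iff_iff.mpr (by simpa using not_congr h1)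

open Classical in
/-- The path all of whose down-steps are forced by the occurrences of `DUD` in `p`. -/
noncomputable def canon (p : List Bool) : List Bool :=
  (List.range p.length).map fun i => decide (¬ Forced (pad true true true p) i)

lemma pad_canon (p : List Bool) (i : ℕ) :
    pad true true true (canon p) (i + 3) = false ↔ Forced (pad true true true p) i := by
  rcases lt_or_ge i p.length with hi | hi
  · simp [pad, canon, hi]
  · have h1 : pad true true true (canon p) (i + 3) = true := by simp [pad, canon, hi]
    have h2 : pad true true true p (i + 3) = true := by simp [pad, hi]
    rw [h1]
    refine ⟨fun h => by simp at h, fun h => ?_⟩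
    rw [eq_false_of_forced h] at h2
    simp at h2

lemma canon_pathEquiv (p : List Bool) : PathEquiv [false, true, false] (canon p) p := by
  refine ⟨by simp [canon], fun i => ?_⟩
  rw [occursAt_iff, occursAt_iff]
  exact occ_iff_of_forced (pad_canon p) i

lemma canonical_canon (p : List Bool) : Canonical (pad true true true (canon p)) := by
  intro i hi
  rw [pad_canon] at hi
  simp only [occ_congr (canon_pathEquiv p)]
  unfold Forced at hi
  tauto

lemma canon_forall₂ (p : List Bool) :
    List.Forall₂ (fun a b => a = false → b = false) (canon p) p := by
  rw [List.forall₂_iff_get]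
  refine ⟨by simp [canon], fun i h1 h2 h => ?_⟩
  have h3 := eq_false_of_forced ((pad_canon p i).1 (by simpa [pad, h1] using h))
  simpa [pad, h2] using h3

lemma count_false_le_of_forall₂ {p q : List Bool}
    (h : List.Forall₂ (fun a b => a = false → b = false) p q) :
    p.count false ≤ q.count false := by
  induction h with
  | nil => simp
  | cons h _ ih => simp only [List.count_cons]; grind

/-! ### Reversal -/

/-- Every suffix of `w` has at least as many up-steps as down-steps. -/
def SuffixBallot (w : List Bool) : Prop := ∀ k, (w.drop k).count false ≤ (w.drop k).count true

lemma SuffixBallot.canon {w : List Bool} (h : SuffixBallot w) : SuffixBallot (canon w) := by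
  intro k
  have h1 := count_false_le_of_forall₂ (List.forall₂_drop k (canon_forall₂ w))
  have h2 := List.count_false_add_count_true (w.drop k)
  have h3 := List.count_false_add_count_true ((DudClasses.canon w).drop k)
  have h4 : ((DudClasses.canon w).drop k).length = (w.drop k).length := by
    simp [DudClasses.canon]
  have := h k
  omega

lemma isBallot_reverse {w : List Bool} : IsBallot w.reverse ↔ SuffixBallot w := by
  constructor
  · intro h k
    rcases le_or_gt k w.length with hk | hk
    · have := h (w.length - k)
      rw [List.take_reverse, List.count_reverse, List.count_reverse,
        Nat.sub_sub_self hk] at this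
      exact this
    · simp [List.drop_eq_nil_of_le hk.le]
  · intro h k
    rw [List.take_reverse, List.count_reverse, List.count_reverse]
    exact h _

lemma occursAt_iff_getElem? (p : List Bool) (i : ℕ) : OccursAt [false, true, false] p i ↔
    p[i]? = some false ∧ p[i + 1]? = some true ∧ p[i + 2]? = some false := by
  have key (k : ℕ) : p[i + k]? = (p.drop i)[k]? := by simp
  unfold OccursAt
  rw [key 1, key 2, show p[i]? = p[i + 0]? from rfl, key 0]
  rcases p.drop i with _ | ⟨a, _ | ⟨b, _ | ⟨c, l⟩⟩⟩ <;> simp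

lemma occursAt_reverse (p : List Bool) (i : ℕ) : OccursAt [false, true, false] p.reverse i ↔
    i + 3 ≤ p.length ∧ OccursAt [false, true, false] p (p.length - 3 - i) := by
  rcases le_or_gt (i + 3) p.length with hi | hi
  · rw [occursAt_iff_getElem?, occursAt_iff_getElem?, List.getElem?_reverse (by omega),
      List.getElem?_reverse (by omega), List.getElem?_reverse (by omega),
      show p.length - 1 - i = p.length - 3 - i + 2 by omega,
      show p.length - 1 - (i + 1) = p.length - 3 - i + 1 by omega,
      show p.length - 1 - (i + 2) = p.length - 3 - i by omega]
    tauto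
  · rw [occursAt_iff_getElem?]
    have : p.reverse[i + 2]? = none := by simp; omega
    rw [this]
    simp
    omega

lemma pathEquiv_reverse {p q : List Bool} (h : PathEquiv [false, true, false] p q) :
    PathEquiv [false, true, false] p.reverse q.reverse := by
  refine ⟨by simpa using h.1, fun i => ?_⟩
  rw [occursAt_reverse, occursAt_reverse, h.1, h.2]

/-- Each class contains exactly one path whose reversal is canonical. -/
lemma numBallotClasses_eq (n : ℕ) : numBallotClasses [false, true, false] n =
    Nat.card {w : List Bool //
      (SuffixBallot w ∧ w.length = n) ∧ Canonical (pad true true true w)} := by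
  symm
  refine Nat.card_eq_of_bijective
    (fun w => Quotient.mk (ballotSetoid [false, true, false] n)
      ⟨w.1.reverse, isBallot_reverse.2 w.2.1.1, by simpa using w.2.1.2⟩) ⟨?_, ?_⟩
  · rintro ⟨v, hv⟩ ⟨w, hw⟩ h
    have h := pathEquiv_reverse (Quotient.exact h : PathEquiv _ v.reverse w.reverse)
    rw [List.reverse_reverse, List.reverse_reverse] at h
    exact Subtype.ext (hv.2.eq_of_pathEquiv hw.2 h)
  · intro c
    induction c using Quotient.inductionOn with
    | h p =>
      obtain ⟨p, hp, hn⟩ := p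
      have hs : SuffixBallot p.reverse := isBallot_reverse.1 (by simpa using hp)
      refine ⟨⟨canon p.reverse, ⟨hs.canon, by simpa [canon] using hn⟩, canonical_canon _⟩,
        Quotient.sound ?_⟩
      have := pathEquiv_reverse (canon_pathEquiv p.reverse)
      rwa [List.reverse_reverse] at this

/-! ### An automaton for canonical words -/

/-- The states of a finite automaton that recognizes canonical words. -/
inductive State
  /-- No constraint from the letters read so far. -/
  | free
  /-- A `D` has been read and `UD` must follow. -/
  | needUD
  /-- `DU` has been read and `D` must follow. -/
  | needD
  /-- A `DUD` has just been completed. -/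
  | dud
  /-- A `DUD` has just been completed and followed by `U`. -/
  | dudU
  /-- A `DUD` has just been completed and followed by `D`. -/
  | dudD
  /-- The word is rejected. -/
  | dead

namespace State

/-- The transition function. -/
def step : State → Bool → State
  | free, true => free
  | free, false => needUD
  | needUD, true => needD
  | needUD, false => dead
  | needD, true => dead
  | needD, false => dud
  | dud, true => dudU
  | dud, false => dudD
  | dudU, true => free
  | dudU, false => dud
  | dudD, true => needD
  | dudD, false => needUD
  | dead, _ => dead

/-- The accepting states. -/
def accepting : State → Bool
  | free | dud | dudU => true
  | _ => false

/-- The automaton accepts the word when started in the state `q`. -/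
def Accepts (q : State) : List Bool → Prop
  | [] => q.accepting = true
  | b :: w => (q.step b).Accepts w

lemma not_accepts_dead (w : List Bool) : ¬ dead.Accepts w := by
  induction w with
  | nil => simp [Accepts, accepting]
  | cons b w ih => simpa [Accepts, step] using ih

end State

lemma canonical_pad_nil (c b a : Bool) : Canonical (pad c b a []) := by
  intro i hi
  simp [pad] at hi

lemma canonical_pad_cons (c b a e : Bool) (w : List Bool) :
    Canonical (pad c b a (e :: w)) ↔
      (e = false → Occ (pad c b a (e :: w)) 3 ∨ Occ (pad c b a (e :: w)) 1 ∨
        (Occ (pad c b a (e :: w)) 0 ∧ Occ (pad c b a (e :: w)) 4)) ∧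
      Canonical (pad b a e w) := by
  have h (i : ℕ) : Occ (pad c b a (e :: w)) (i + 1) ↔ Occ (pad b a e w) i := by
    simp [Occ, pad]
  unfold Canonical
  rw [← Nat.and_forall_add_one]
  simp only [h, zero_add, show ∀ i, pad c b a (e :: w) (i + 1) = pad b a e w i from
    fun i => by simp [pad], add_right_comm _ 1]
  simp [pad, add_right_comm _ 1]

open State in
lemma accepts_iff_canonical (w : List Bool) :
    (∀ b, free.Accepts w ↔ Canonical (pad b true true w)) ∧
    (dud.Accepts w ↔ Canonical (pad false true false w)) ∧
    (dudU.Accepts w ↔ Canonical (pad true false true w)) := by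
  induction hn : w.length using Nat.strong_induction_on generalizing w with
  | _ n ih =>
    rcases w with _ | ⟨_ | _, w⟩
    · simp [Accepts, accepting, canonical_pad_nil]
    · have hw := ih w.length (by simp [← hn]) w rfl
      refine ⟨fun b => ?_, ?_, ?_⟩
      · rcases w with _ | ⟨_ | _, _ | ⟨_ | _, w⟩⟩
        case cons.true.cons.false =>
          have hw := ih w.length (by simp [← hn]; omega) w rfl
          simp [Accepts, step, canonical_pad_cons, Occ, pad, hw.2.1]
        all_goals simp [Accepts, accepting, not_accepts_dead, step, canonical_pad_cons, Occ, pad]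
      · rcases w with _ | ⟨_ | _, _ | ⟨_ | _, w⟩⟩
        case cons.true.cons.false =>
          have hw := ih w.length (by simp [← hn]; omega) w rfl
          simp [Accepts, step, canonical_pad_cons, Occ, pad, hw.2.1]
        case cons.false.cons.true =>
          rcases w with _ | ⟨_ | _, w⟩
          case cons.false =>
            have hw := ih w.length (by simp [← hn]; omega) w rfl
            simp [Accepts, step, canonical_pad_cons, Occ, pad, hw.2.1]
          all_goals simp [Accepts, accepting, not_accepts_dead, step, canonical_pad_cons, Occ, pad]
        all_goals simp [Accepts, accepting, not_accepts_dead, step, canonical_pad_cons, Occ, pad]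
      · simp [Accepts, step, canonical_pad_cons, Occ, pad, hw.2.1]
    · have hw := ih w.length (by simp [← hn]) w rfl
      refine ⟨fun b => ?_, ?_, ?_⟩
      · simp [Accepts, step, canonical_pad_cons, ← hw.1]
      · simp [Accepts, step, canonical_pad_cons, hw.2.2]
      · simp [Accepts, step, canonical_pad_cons, ← hw.1]

/-! ### Counting -/

/-- `w`, read backwards, is a ballot path that ends at height `h`. -/
def EndsAt : ℕ → List Bool → Prop
  | h, [] => h = 0
  | h, false :: w => EndsAt (h + 1) w
  | 0, true :: _ => False
  | h + 1, true :: w => EndsAt h w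

lemma suffixBallot_cons (b : Bool) (w : List Bool) : SuffixBallot (b :: w) ↔
    (b :: w).count false ≤ (b :: w).count true ∧ SuffixBallot w := by
  unfold SuffixBallot
  rw [← Nat.and_forall_add_one]
  simp

lemma endsAt_iff (h : ℕ) (w : List Bool) :
    EndsAt h w ↔ SuffixBallot w ∧ w.count true = w.count false + h := by
  induction w generalizing h with
  | nil => simp [EndsAt, SuffixBallot, eq_comm]
  | cons b w ih =>
    rw [suffixBallot_cons]
    cases b
    · rw [EndsAt, ih]
      simp
      grind
    · cases h with
      | zero =>
        simp only [EndsAt, false_iff]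
        rintro ⟨⟨-, h1⟩, h2⟩
        have := h1 0
        simp at this h2
        omega
      | succ h =>
        rw [EndsAt, ih]
        simp
        grind

/-- The words of length `n` accepted from `q` that, read backwards, are ballot paths
ending at height `h`. -/
def words (q : State) : ℕ → ℕ → Finset (List Bool)
  | 0, 0 => if q.accepting then {[]} else ∅
  | 0, _ + 1 => ∅
  | n + 1, 0 => (words (q.step false) n 1).map ⟨_, List.cons_injective (a := false)⟩
  | n + 1, h + 1 =>
    ((words (q.step false) n (h + 2)).map ⟨_, List.cons_injective (a := false)⟩).disjUnion
      ((words (q.step true) n h).map ⟨_, List.cons_injective (a := true)⟩)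
      (by simp [Finset.disjoint_left])

lemma mem_words (q : State) (n h : ℕ) (w : List Bool) :
    w ∈ words q n h ↔ w.length = n ∧ EndsAt h w ∧ q.Accepts w := by
  induction n generalizing q h w with
  | zero =>
    cases h with
    | zero =>
      rw [words]
      split_ifs with hq <;> cases w <;> simp [EndsAt, State.Accepts, hq]
    | succ h => cases w <;> simp [words, EndsAt]
  | succ n ih =>
    rcases h with _ | h <;> rcases w with _ | ⟨_ | _, w⟩ <;>
      simp [words, EndsAt, State.Accepts, ih]

lemma EndsAt.le_length {h : ℕ} {w : List Bool} (hw : EndsAt h w) : h ≤ w.length := by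
  have := ((endsAt_iff h w).1 hw).2
  have := List.count_le_length (a := true) (l := w)
  omega

lemma numBallotClasses_eq_sum {n m : ℕ} (hnm : n < m) :
    numBallotClasses [false, true, false] n =
      ∑ h ∈ Finset.range m, (words .free n h).card := by
  rw [numBallotClasses_eq, ← Finset.card_biUnion]
  · refine Nat.subtype_card _ fun w => ?_
    simp only [Finset.mem_biUnion, Finset.mem_range, mem_words]
    constructor
    · rintro ⟨h, -, h1, h2, h3⟩
      exact ⟨⟨((endsAt_iff h w).1 h2).1, h1⟩, ((accepts_iff_canonical w).1 true).1 h3⟩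
    · rintro ⟨⟨h1, h2⟩, h3⟩
      have h4 : EndsAt (w.count true - w.count false) w := by
        rw [endsAt_iff]
        have := h1 0
        simp only [List.drop_zero] at this
        exact ⟨h1, by omega⟩
      exact ⟨_, by have := h4.le_length; omega, h2, h4, ((accepts_iff_canonical w).1 true).2 h3⟩
  · intro h _ h' _ hh
    simp only [Function.onFun, Finset.disjoint_left, mem_words]
    rintro w ⟨-, h1, -⟩ ⟨-, h2, -⟩
    rw [endsAt_iff] at h1 h2
    omega

/-! ### Generating functions -/

open PowerSeries

/-- A polynomial equation `Z = 1 + X P(Z)` has a solution in power series. -/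
lemma exists_eq_one_add_X_mul_eval (P : Polynomial ℚ⟦X⟧) :
    ∃ Z : ℚ⟦X⟧, Z = 1 + X * P.eval Z := by
  let f : ℕ → ℚ⟦X⟧ := fun k => (fun Z => 1 + X * P.eval Z)^[k] 0
  have hf (k : ℕ) : f (k + 1) = 1 + X * P.eval (f k) := Function.iterate_succ_apply' _ _ _
  have hstep (k : ℕ) : X ^ k ∣ f (k + 1) - f k := by
    induction k with
    | zero => simp
    | succ k ih =>
      rw [hf (k + 1), hf k, add_sub_add_left_eq_sub, ← mul_sub, pow_succ', ← hf k]
      exact mul_dvd_mul_left _ (ih.trans (P.sub_dvd_eval_sub _ _))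
  have hadd (k m : ℕ) : X ^ k ∣ f (k + m) - f k := by
    induction m with
    | zero => simp
    | succ m ih =>
      have := dvd_add ((pow_dvd_pow X (Nat.le_add_right k m)).trans (hstep (k + m))) ih
      simpa [add_assoc] using this
  let Z : ℚ⟦X⟧ := PowerSeries.mk fun n => coeff n (f (n + 1))
  have hZ (k : ℕ) : X ^ k ∣ Z - f k := by
    rw [X_pow_dvd_iff]
    intro m hm
    obtain ⟨j, rfl⟩ := Nat.exists_eq_add_of_lt hm
    have := X_pow_dvd_iff.1 (hadd (m + 1) j) m (Nat.lt_succ_self m)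
    rw [map_sub, sub_eq_zero] at this ⊢
    rw [coeff_mk, ← this]
    congr 2
    ring
  refine ⟨Z, ?_⟩
  rw [← sub_eq_zero]
  ext n
  refine X_pow_dvd_iff.1 (?_ : X ^ (n + 1) ∣ _) n (Nat.lt_succ_self n)
  have h1 := hZ (n + 1)
  have h2 : X ^ (n + 1) ∣ P.eval (f n) * X - P.eval Z * X := by
    rw [← sub_mul, pow_succ]
    exact mul_dvd_mul_right (((dvd_sub_comm).1 (hZ n)).trans (P.sub_dvd_eval_sub _ _)) _
  have := dvd_add h1 h2
  rw [hf] at this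
  convert this using 1
  ring

/-- The generating functions of the sets `words q n h`, in terms of a solution `Z` of
`Z = 1 + X² Z + X⁴ Z R (1 + X² R)` where `R = 1 + X⁴ Z`. -/
noncomputable def wordsGF (Z : ℚ⟦X⟧) : State → ℕ → ℚ⟦X⟧
  | .free, h => (1 + X ^ 4 * Z) * (X * (1 + X ^ 4 * Z)) ^ h
  | .needUD, 0 => 0
  | .needUD, h + 1 => X ^ 3 * Z * (X * (1 + X ^ 4 * Z)) ^ h
  | .needD, h => X ^ 2 * Z * (X * (1 + X ^ 4 * Z)) ^ h
  | .dud, 0 => 1 + X ^ 4 * Z * (1 + X ^ 2 * (1 + X ^ 4 * Z))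
  | .dud, h + 1 => X * Z * (X * (1 + X ^ 4 * Z)) ^ h
  | .dudU, h => (1 + X ^ 2 * Z) * (X * (1 + X ^ 4 * Z)) ^ h
  | .dudD, 0 => X ^ 4 * Z
  | .dudD, h + 1 => X ^ 3 * Z * (1 + X ^ 2 * (1 + X ^ 4 * Z)) * (X * (1 + X ^ 4 * Z)) ^ h
  | .dead, _ => 0

variable {Z : ℚ⟦X⟧}

lemma wordsGF_zero (q : State) :
    wordsGF Z q 0 = (if q.accepting then 1 else 0) + X * wordsGF Z (q.step false) 1 := by
  cases q <;> simp [wordsGF, State.accepting, State.step] <;> ring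

lemma wordsGF_succ (hZ : Z = 1 + X ^ 2 * Z +
      X ^ 4 * Z * (1 + X ^ 4 * Z) * (1 + X ^ 2 * (1 + X ^ 4 * Z))) (q : State) (h : ℕ) :
    wordsGF Z q (h + 1) =
      X * (wordsGF Z (q.step false) (h + 2) + wordsGF Z (q.step true) h) := by
  cases q
  case dud =>
    cases h <;> simp only [wordsGF, State.step]
    · linear_combination X * hZ
    · rename_i h
      linear_combination X * (X * (1 + X ^ 4 * Z)) ^ (h + 1) * hZ
  all_goals cases h <;> simp only [wordsGF, State.step] <;> ring

lemma card_words (hZ : Z = 1 + X ^ 2 * Z +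
      X ^ 4 * Z * (1 + X ^ 4 * Z) * (1 + X ^ 2 * (1 + X ^ 4 * Z))) (q : State) (n h : ℕ) :
    ((words q n h).card : ℚ) = coeff n (wordsGF Z q h) := by
  induction n generalizing q h with
  | zero =>
    cases h with
    | zero =>
      rw [wordsGF_zero, words]
      split_ifs <;> simp
    | succ h =>
      rw [wordsGF_succ hZ, words]
      simp
  | succ n ih =>
    cases h with
    | zero =>
      rw [wordsGF_zero, words, map_add, coeff_succ_X_mul, ← ih, Finset.card_map]
      split_ifs <;> simp [coeff_one]
    | succ h =>
      rw [wordsGF_succ hZ, words, coeff_succ_X_mul, map_add, ← ih, ← ih, Finset.card_disjUnion,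
        Finset.card_map, Finset.card_map, Nat.cast_add]

lemma classesGF_mul (hZ : Z = 1 + X ^ 2 * Z +
      X ^ 4 * Z * (1 + X ^ 4 * Z) * (1 + X ^ 2 * (1 + X ^ 4 * Z))) :
    (PowerSeries.mk fun n => (numBallotClasses [false, true, false] n : ℚ)) *
      (1 - X * (1 + X ^ 4 * Z)) = 1 + X ^ 4 * Z := by
  set r : ℚ⟦X⟧ := X * (1 + X ^ 4 * Z) with hr
  set B : ℚ⟦X⟧ := PowerSeries.mk fun n => (numBallotClasses [false, true, false] n : ℚ) with hB
  rw [← sub_eq_zero]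
  ext n
  refine X_pow_dvd_iff.1 (?_ : X ^ (n + 1) ∣ _) n (Nat.lt_succ_self n)
  have h1 : X ^ (n + 1) ∣ B - (1 + X ^ 4 * Z) * ∑ h ∈ Finset.range (n + 1), r ^ h := by
    rw [X_pow_dvd_iff]
    intro m hm
    rw [map_sub, sub_eq_zero, hB, coeff_mk, numBallotClasses_eq_sum hm, Finset.mul_sum, map_sum,
      Nat.cast_sum]
    exact Finset.sum_congr rfl fun h _ => card_words hZ .free m h
  have h2 : X ^ (n + 1) ∣ (1 + X ^ 4 * Z) * r ^ (n + 1) :=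
    (pow_dvd_pow_of_dvd (dvd_mul_right _ _) _).mul_left _
  have h3 := geom_sum_mul r (n + 1)
  have := dvd_sub (h1.mul_right (1 - r)) h2
  convert this using 1
  linear_combination (-(1 + X ^ 4 * Z)) * h3

end DudClasses

open PowerSeries in
/-- the generating function of the numbers of DUD-equivalence classes of
ballot paths satisfies the stated cubic equation. -/
theorem dud_classes_gf (B : PowerSeries ℚ)
    (hB : B = PowerSeries.mk fun n => (numBallotClasses [false, true, false] n : ℚ)) :
    X ^ 2 * (1 - X - X ^ 2) * B ^ 3 +
      (2 * X - 3 * X ^ 2 - 2 * X ^ 3 + 2 * X ^ 4 + 2 * X ^ 5 - 2 * X ^ 6) * B ^ 2 +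
      (1 - 3 * X - X ^ 2 + 3 * X ^ 3 + X ^ 4 - 3 * X ^ 5) * B - 1 + X ^ 2 - X ^ 4 = 0 := by
  obtain ⟨Z, hZ⟩ := DudClasses.exists_eq_one_add_X_mul_eval
    (Polynomial.C X * Polynomial.X + Polynomial.C (X ^ 3) * Polynomial.X *
      (1 + Polynomial.C (X ^ 4) * Polynomial.X) *
        (1 + Polynomial.C (X ^ 2) * (1 + Polynomial.C (X ^ 4) * Polynomial.X)))
  simp only [Polynomial.eval_add, Polynomial.eval_mul, Polynomial.eval_C, Polynomial.eval_X,
    Polynomial.eval_one] at hZ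
  have hZ' : Z = 1 + X ^ 2 * Z +
      X ^ 4 * Z * (1 + X ^ 4 * Z) * (1 + X ^ 2 * (1 + X ^ 4 * Z)) := by
    linear_combination hZ
  have h := DudClasses.classesGF_mul hZ'
  rw [← hB] at h
  generalize hR : 1 + X ^ 4 * Z = R at h hZ'
  have hR' : (R - 1) * (1 - X ^ 2 - X ^ 4 * R - X ^ 6 * R ^ 2) - X ^ 4 = 0 := by
    rw [← hR] at hZ' ⊢
    linear_combination X ^ 4 * hZ'
  have h1 : B - R * (1 + X * B) = 0 := by linear_combination h
  linear_combination (1 + X * B) ^ 3 * hR' + h1 *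
    (-X ^ 6 * (B ^ 2 + B * (R * (1 + X * B)) + (R * (1 + X * B)) ^ 2) +
      (X ^ 6 - X ^ 4) * (1 + X * B) * (B + R * (1 + X * B)) +
      (1 - X ^ 2 + X ^ 4) * (1 + X * B) ^ 2)
end
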